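/- Let q = 5, ε ∈ (0, 1/2], and write α = α_ε. Let h₅(x) = x log₂ 4 − x log₂ x − (1−x) log₂(1−x), for 0 < r ≤ log₂ 5 let δ_GV(r; 5) be the unique δ ∈ [0, 4/5] with r = log₂ 5 − h₅(δ), and set R₊* = log₂ 5 − (1/2) h₅(1 − (1+2α)^{−2}). Then for every rate R with log₂ √5 ≤ R ≤ R₊*, the reliability function of the typewriter channel with q = 5 satisfies E(R) ≥ −(1/2) δ_GV(2R − log₂ 5; 5) log₂(α(1+α)). -/

import Mathlib

/-- The typewriter channel transition probabilities on `ZMod q`. -/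
noncomputable def W (q : ℕ) (ε : ℝ) (y x : ZMod q) : ℝ :=
  if y = x then 1 - ε else if y = x + 1 then ε else 0

/-- `α_ε = √(ε(1-ε))`. -/
noncomputable def alphaE (ε : ℝ) : ℝ := Real.sqrt (ε * (1 - ε))

/-- The `n`-fold memoryless extension `Wⁿ(y|x) = ∏ₖ W(yₖ|xₖ)`. -/
noncomputable def Wn (q : ℕ) [NeZero q] (n : ℕ) (ε : ℝ) (y x : Fin n → ZMod q) : ℝ :=
  ∏ k, W q ε (y k) (x k)

/-- `Pe(M,n)`: the smallest average error probability over all encoders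
`f : Fin M → (ZMod q)ⁿ` and decoders `φ : (ZMod q)ⁿ → Fin M`. -/
noncomputable def Pe (q : ℕ) [NeZero q] (ε : ℝ) (M n : ℕ) : ℝ :=
  sInf {p : ℝ | ∃ f : Fin M → (Fin n → ZMod q), ∃ φ : (Fin n → ZMod q) → Fin M,
    p = (1 / M) * ∑ m : Fin M, ∑ y : Fin n → ZMod q,
      if φ y = m then 0 else Wn q n ε y (f m)}

/-- The reliability function
`E(R) = limsup_{n→∞} (1/n) log₂ (1 / Pe(⌈2^{nR}⌉, n))`. -/
noncomputable def EReliability (q : ℕ) [NeZero q] (ε : ℝ) (R : ℝ) : ℝ :=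
  Filter.limsup (fun n : ℕ =>
    (1 / (n : ℝ)) * Real.logb 2 (1 / Pe q ε (⌈(2 : ℝ) ^ ((n : ℝ) * R)⌉₊) n))
    Filter.atTop

/-- Binary entropy function (base 2), extended by `log 0 = 0`. -/
noncomputable def h2 (x : ℝ) : ℝ := -(x * Real.logb 2 x) - (1 - x) * Real.logb 2 (1 - x)

/-- `q`-ary entropy-type function `h₅` (here with `q-1 = 4`). -/
noncomputable def h5 (x : ℝ) : ℝ :=
  x * Real.logb 2 4 - x * Real.logb 2 x - (1 - x) * Real.logb 2 (1 - x)

/-- The kernel on `ZMod 5` equal to `1` on the diagonal, `t` at distance one and `0` at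
distance two. -/
noncomputable def pentagonKernel (t : ℝ) (x y : ZMod 5) : ℝ :=
  if x = y then 1 else if y = x + 1 ∨ x = y + 1 then t else 0

lemma W_nonneg {ε : ℝ} (hε : 0 < ε) (hε' : ε ≤ 1 / 2) (y x : ZMod 5) : 0 ≤ W 5 ε y x := by
  unfold W; split_ifs <;> linarith

lemma W_eq_zero_or_le {ε : ℝ} (hε' : ε ≤ 1 / 2) (y x : ZMod 5) :
    W 5 ε y x = 0 ∨ ε ≤ W 5 ε y x := by
  unfold W; split_ifs
  · right; linarith
  · right; exact le_rfl
  · left; rfl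

lemma sum_zmod_five (f : ZMod 5 → ℝ) : ∑ y, f y = f 0 + f 1 + f 2 + f 3 + f 4 :=
  Fin.sum_univ_five f

lemma zmod_five_cases (x : ZMod 5) : x = 0 ∨ x = 1 ∨ x = 2 ∨ x = 3 ∨ x = 4 := by
  decide +revert

lemma sum_sqrt_W {ε : ℝ} (hε : 0 < ε) (hε' : ε ≤ 1 / 2) (x x' : ZMod 5) :
    ∑ y, √(W 5 ε y x * W 5 ε y x') = pentagonKernel (alphaE ε) x x' := by
  have e1 : √((1 - ε) * (1 - ε)) = 1 - ε := Real.sqrt_mul_self (by linarith)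
  have e2 : √(ε * ε) = ε := Real.sqrt_mul_self hε.le
  have e3 : √((1 - ε) * ε) = √(ε * (1 - ε)) := by rw [mul_comm]
  rw [sum_zmod_five]
  unfold W pentagonKernel alphaE
  rcases zmod_five_cases x with rfl | rfl | rfl | rfl | rfl <;>
    rcases zmod_five_cases x' with rfl | rfl | rfl | rfl | rfl <;>
    simp (disch := decide) only [if_pos, if_neg, mul_zero, zero_mul, Real.sqrt_zero, e1, e2, e3] <;>
    ring

lemma sum_pentagonKernel_mul (t : ℝ) (a v v' : ZMod 5) :
    ∑ a', pentagonKernel t a a' * pentagonKernel t (2 * a + v) (2 * a' + v') =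
      if v = v' then 1 else t * (1 + t) := by
  have hk : ∀ x y : ZMod 5, pentagonKernel t x y = pentagonKernel t 0 (y - x) := by
    intro x y
    have h1 : x = y ↔ 0 = y - x := by rw [eq_comm, ← sub_eq_zero, eq_comm]
    have h2 : (y = x + 1 ∨ x = y + 1) ↔ (y - x = 0 + 1 ∨ 0 = y - x + 1) := by
      decide +revert
    simp only [pentagonKernel, h1, h2]
  have hsub : ∑ a', pentagonKernel t a a' * pentagonKernel t (2 * a + v) (2 * a' + v') =
      ∑ a', pentagonKernel t 0 a' * pentagonKernel t 0 (2 * a' + (v' - v)) := by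
    rw [← Equiv.sum_comp (Equiv.addRight a)]
    refine Finset.sum_congr rfl fun x _ => ?_
    rw [hk a, hk (2 * a + v), Equiv.coe_addRight]
    congr 2 <;> ring
  have hv : v = v' ↔ v' - v = 0 := by rw [sub_eq_zero, eq_comm]
  rw [hsub, sum_zmod_five]
  simp only [hv, pentagonKernel]
  generalize v' - v = d
  rcases zmod_five_cases d with rfl | rfl | rfl | rfl | rfl <;>
    simp (disch := decide) only [if_pos, if_neg] <;> ring

/-- Spectral decomposition of the extremal kernel in Lovász' bound for the pentagon. -/
lemma exists_pentagonKernel_decomposition : ∃ (t : ℝ) (l : Fin 3 → ℝ) (e : Fin 3 → ZMod 5 → ℝ),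
    (∀ i, 0 ≤ l i) ∧ l 0 = (√5)⁻¹ ∧ (∀ x, e 0 x = 1) ∧
    ∀ x y, pentagonKernel t x y = ∑ i, l i * (e i x * e i y) := by
  have h5 : √5 * √5 = (5 : ℝ) := Real.mul_self_sqrt (by norm_num)
  have h5' : (√5)⁻¹ = √5 / 5 := by
    rw [inv_eq_iff_eq_inv, inv_div, eq_div_iff (by positivity)]; exact h5
  have hle : √5 ≤ 5 := by nlinarith [Real.sqrt_nonneg (5 : ℝ)]
  have hnn := Real.sqrt_nonneg (5 : ℝ)
  generalize √5 = w at *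
  refine ⟨(w - 1) / 2, ![w / 5, 1 - w / 5, (1 - w / 5) * ((5 + w) / 8)],
    ![fun _ => 1,
      fun x => if x = 0 then 1 else if x = 1 ∨ x = 4 then (w - 1) / 4 else (-w - 1) / 4,
      fun x => if x = 0 then 0 else if x = 1 then 1 else if x = 2 then (w - 1) / 2
        else if x = 3 then -((w - 1) / 2) else -1], ?_, ?_, ?_, ?_⟩
  · intro i
    fin_cases i
    · exact div_nonneg hnn (by norm_num)
    · change 0 ≤ 1 - w / 5
      linarith
    · exact mul_nonneg (by linarith) (by linarith)
  · exact h5'.symm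
  · exact fun _ => rfl
  · intro x y
    rw [Fin.sum_univ_three]
    simp only [pentagonKernel, Matrix.cons_val_zero, Matrix.cons_val_one, Matrix.cons_val]
    have h3 : w ^ 2 = 5 := by rw [sq, h5]
    have h4 : w ^ 3 = 5 * w := by rw [pow_succ, h3]
    have h5 : w ^ 4 = 25 := by rw [show w ^ 4 = (w ^ 2) ^ 2 by ring, h3]; norm_num
    rcases zmod_five_cases x with rfl | rfl | rfl | rfl | rfl <;>
      rcases zmod_five_cases y with rfl | rfl | rfl | rfl | rfl <;>
      simp (disch := decide) only [if_pos, if_neg] <;>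
      ring_nf <;> simp only [h3, h4, h5] <;> ring

lemma Wn_nonneg {ε : ℝ} (hε : 0 < ε) (hε' : ε ≤ 1 / 2) {n : ℕ} (y x : Fin n → ZMod 5) :
    0 ≤ Wn 5 n ε y x :=
  Finset.prod_nonneg fun _ _ => W_nonneg hε hε' _ _

lemma Wn_eq_zero_or_le {ε : ℝ} (hε : 0 < ε) (hε' : ε ≤ 1 / 2) {n : ℕ} (y x : Fin n → ZMod 5) :
    Wn 5 n ε y x = 0 ∨ ε ^ n ≤ Wn 5 n ε y x := by
  by_cases h : ∃ k, W 5 ε (y k) (x k) = 0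
  · obtain ⟨k, hk⟩ := h
    exact Or.inl (Finset.prod_eq_zero (Finset.mem_univ k) hk)
  · push Not at h
    right
    calc ε ^ n = ∏ _k : Fin n, ε := by simp
      _ ≤ _ := Finset.prod_le_prod (fun _ _ => hε.le) fun k _ =>
        (W_eq_zero_or_le hε' (y k) (x k)).resolve_left (h k)

/-- The Bhattacharyya coefficient of two channel inputs factorizes over the coordinates. -/
lemma sum_sqrt_Wn {ε : ℝ} (hε : 0 < ε) (hε' : ε ≤ 1 / 2) {n : ℕ} (x x' : Fin n → ZMod 5) :
    ∑ y, √(Wn 5 n ε y x * Wn 5 n ε y x') = ∏ k, pentagonKernel (alphaE ε) (x k) (x' k) := by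
  simp_rw [← sum_sqrt_W hε hε']
  rw [Fintype.prod_sum]
  refine Finset.sum_congr rfl fun y _ => ?_
  simp_rw [Real.sqrt_eq_rpow]
  rw [Real.finsetProd_rpow _ _ fun k _ => mul_nonneg (W_nonneg hε hε' _ _) (W_nonneg hε hε' _ _),
    Finset.prod_mul_distrib]
  rfl

lemma finite_setOf_error (ε : ℝ) (M n : ℕ) :
    {p : ℝ | ∃ f : Fin M → (Fin n → ZMod 5), ∃ φ : (Fin n → ZMod 5) → Fin M,
      p = (1 / M) * ∑ m : Fin M, ∑ y : Fin n → ZMod 5,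
        if φ y = m then 0 else Wn 5 n ε y (f m)}.Finite := by
  refine (Set.finite_range fun c : (Fin M → (Fin n → ZMod 5)) × ((Fin n → ZMod 5) → Fin M) =>
    (1 / (M : ℝ)) * ∑ m : Fin M, ∑ y : Fin n → ZMod 5,
        if c.2 y = m then 0 else Wn 5 n ε y (c.1 m)).subset ?_
  rintro p ⟨f, φ, rfl⟩
  exact ⟨(f, φ), rfl⟩

lemma exists_Pe_eq (ε : ℝ) {M : ℕ} (hM : 0 < M) (n : ℕ) :
    ∃ f : Fin M → (Fin n → ZMod 5), ∃ φ : (Fin n → ZMod 5) → Fin M,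
      Pe 5 ε M n = (1 / M) * ∑ m : Fin M, ∑ y : Fin n → ZMod 5,
        if φ y = m then 0 else Wn 5 n ε y (f m) :=
  Set.Nonempty.csInf_mem (s := {p : ℝ | ∃ f : Fin M → (Fin n → ZMod 5),
      ∃ φ : (Fin n → ZMod 5) → Fin M, p = (1 / M) * ∑ m : Fin M, ∑ y : Fin n → ZMod 5,
        if φ y = m then 0 else Wn 5 n ε y (f m)})
    ⟨_, fun _ _ => 0, fun _ => ⟨0, hM⟩, rfl⟩ (finite_setOf_error ε M n)

/-- The union bound with Bhattacharyya coefficients for maximum likelihood decoding. -/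
lemma Pe_le_of_forall_sum_le {ε : ℝ} (hε : 0 < ε) (hε' : ε ≤ 1 / 2) {M n : ℕ} (hM : 0 < M)
    (f : Fin M → (Fin n → ZMod 5)) {B : ℝ}
    (hB : ∀ m, ∑ m' ∈ Finset.univ.erase m,
      ∏ k, pentagonKernel (alphaE ε) (f m k) (f m' k) ≤ B) :
    Pe 5 ε M n ≤ B := by
  have : Nonempty (Fin M) := ⟨⟨0, hM⟩⟩
  choose φ hφ using fun y => Finite.exists_max fun m => Wn 5 n ε y (f m)
  have hmem : Pe 5 ε M n ≤ (1 / M) * ∑ m : Fin M, ∑ y : Fin n → ZMod 5,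
      if φ y = m then 0 else Wn 5 n ε y (f m) :=
    csInf_le (finite_setOf_error ε M n).bddBelow ⟨f, φ, rfl⟩
  refine hmem.trans ?_
  have key : ∀ m, (∑ y : Fin n → ZMod 5, if φ y = m then 0 else Wn 5 n ε y (f m)) ≤ B := by
    intro m
    refine le_trans ?_ (hB m)
    simp_rw [← sum_sqrt_Wn hε hε']
    rw [Finset.sum_comm]
    refine Finset.sum_le_sum fun y _ => ?_
    split_ifs with h
    · exact Finset.sum_nonneg fun _ _ => Real.sqrt_nonneg _
    · refine le_trans ?_ (Finset.single_le_sum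
        (f := fun m' => √(Wn 5 n ε y (f m) * Wn 5 n ε y (f m')))
        (fun _ _ => Real.sqrt_nonneg _) (Finset.mem_erase.2 ⟨h, Finset.mem_univ (φ y)⟩))
      refine Real.le_sqrt_of_sq_le ?_
      rw [sq]
      exact mul_le_mul_of_nonneg_left (hφ y m) (Wn_nonneg hε hε' _ _)
  calc (1 / (M : ℝ)) * ∑ m : Fin M, ∑ y : Fin n → ZMod 5,
        (if φ y = m then 0 else Wn 5 n ε y (f m))
      ≤ (1 / (M : ℝ)) * ∑ _m : Fin M, B := by
        gcongr with m
        exact key m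
    _ = B := by
        have : (M : ℝ) ≠ 0 := by positivity
        simp
        field_simp

lemma Pe_eq_zero_or_le {ε : ℝ} (hε : 0 < ε) (hε' : ε ≤ 1 / 2) {M : ℕ} (hM : 0 < M) (n : ℕ) :
    Pe 5 ε M n = 0 ∨ 1 / M * ε ^ n ≤ Pe 5 ε M n := by
  obtain ⟨f, φ, h⟩ := exists_Pe_eq ε hM n
  have hnn : ∀ m y, 0 ≤ if φ y = m then 0 else Wn 5 n ε y (f m) := fun m y => by
    split_ifs
    exacts [le_rfl, Wn_nonneg hε hε' _ _]
  rw [h]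
  by_cases h0 : ∀ m y, (if φ y = m then 0 else Wn 5 n ε y (f m)) = 0
  · left
    simp [h0]
  · right
    push Not at h0
    obtain ⟨m, y, hmy⟩ := h0
    have h1 : ε ^ n ≤ if φ y = m then 0 else Wn 5 n ε y (f m) := by
      split_ifs at hmy ⊢ with hφ
      · exact absurd rfl hmy
      · exact (Wn_eq_zero_or_le hε hε' y (f m)).resolve_left hmy
    gcongr
    refine h1.trans ((Finset.single_le_sum (fun y _ => hnn m y) (Finset.mem_univ y)).trans
      (Finset.single_le_sum
        (f := fun m => ∑ y : Fin n → ZMod 5, if φ y = m then 0 else Wn 5 n ε y (f m))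
        (fun m _ => Finset.sum_nonneg fun y _ => hnn m y) (Finset.mem_univ m)))

/-- Lovász' bound on the size of independent sets in the strong powers of the pentagon. -/
lemma sq_le_of_prod_pentagonKernel_eq_zero {M n : ℕ} (f : Fin M → (Fin n → ZMod 5))
    (hf : ∀ (t : ℝ) (m m' : Fin M), m ≠ m' → ∏ k, pentagonKernel t (f m k) (f m' k) = 0) :
    M ^ 2 ≤ 5 ^ n := by
  obtain ⟨t, l, e, hl, hl0, he0, hK⟩ := exists_pentagonKernel_decomposition
  have h1 : ∑ m, ∑ m', ∏ k, pentagonKernel t (f m k) (f m' k) = M := by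
    have : ∀ m, ∑ m', ∏ k, pentagonKernel t (f m k) (f m' k) = 1 := fun m => by
      rw [Finset.sum_eq_single m (fun m' _ h => hf t m m' h.symm) (by simp)]
      simp [pentagonKernel]
    simp [this]
  have h2 : ∑ m, ∑ m', ∏ k, pentagonKernel t (f m k) (f m' k) =
      ∑ τ : Fin n → Fin 3, (∏ k, l (τ k)) * (∑ m, ∏ k, e (τ k) (f m k)) ^ 2 := by
    have : ∀ m m', ∏ k, pentagonKernel t (f m k) (f m' k) = ∑ τ : Fin n → Fin 3,
        (∏ k, l (τ k)) * ((∏ k, e (τ k) (f m k)) * ∏ k, e (τ k) (f m' k)) := fun m m' => by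
      simp_rw [hK, Fintype.prod_sum, Finset.prod_mul_distrib]
    simp_rw [this]
    rw [Finset.sum_congr rfl fun m _ => Finset.sum_comm, Finset.sum_comm]
    refine Finset.sum_congr rfl fun τ _ => ?_
    rw [sq, Finset.sum_mul_sum]
    simp_rw [Finset.mul_sum]
  have h3 : (√5)⁻¹ ^ n * (M : ℝ) ^ 2 ≤ M := by
    rw [← hl0]
    refine le_trans (le_of_eq ?_) ((Finset.single_le_sum
      (f := fun τ : Fin n → Fin 3 => (∏ k, l (τ k)) * (∑ m, ∏ k, e (τ k) (f m k)) ^ 2)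
      (fun τ _ => mul_nonneg (Finset.prod_nonneg fun _ _ => hl _) (sq_nonneg _))
      (Finset.mem_univ fun _ => 0)).trans (h2.symm.trans h1).le)
    simp [he0]
  rcases Nat.eq_zero_or_pos M with rfl | hM
  · simp
  have hM' : (0 : ℝ) < M := by exact_mod_cast hM
  have h4 : (M : ℝ) ≤ √5 ^ n := by
    rw [inv_pow, inv_mul_le_iff₀ (by positivity)] at h3
    nlinarith
  have h5 : (M : ℝ) ^ 2 ≤ 5 ^ n := by
    calc (M : ℝ) ^ 2 ≤ (√5 ^ n) ^ 2 := by gcongr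
      _ = 5 ^ n := by rw [← pow_mul, mul_comm, pow_mul, Real.sq_sqrt (by norm_num)]
  exact_mod_cast h5

lemma alphaE_pos {ε : ℝ} (hε : 0 < ε) (hε' : ε ≤ 1 / 2) : 0 < alphaE ε :=
  Real.sqrt_pos.2 (mul_pos hε (by linarith))

lemma sq_le_of_Pe_eq_zero {ε : ℝ} (hε : 0 < ε) (hε' : ε ≤ 1 / 2) {M n : ℕ} (hM : 0 < M)
    (h : Pe 5 ε M n = 0) : M ^ 2 ≤ 5 ^ n := by
  obtain ⟨f, φ, hfφ⟩ := exists_Pe_eq ε hM n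
  have hnn : ∀ m y, 0 ≤ if φ y = m then 0 else Wn 5 n ε y (f m) := fun m y => by
    split_ifs
    exacts [le_rfl, Wn_nonneg hε hε' _ _]
  have hM' : (1 / (M : ℝ)) ≠ 0 := by positivity
  rw [h, eq_comm, mul_eq_zero, or_iff_right hM',
    Finset.sum_eq_zero_iff_of_nonneg fun m _ => Finset.sum_nonneg fun y _ => hnn m y] at hfφ
  have hz : ∀ m y, φ y ≠ m → Wn 5 n ε y (f m) = 0 := fun m y hmy => by
    have := (Finset.sum_eq_zero_iff_of_nonneg fun y _ => hnn m y).1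
      (hfφ m (Finset.mem_univ m)) y (Finset.mem_univ y)
    rwa [if_neg hmy] at this
  refine sq_le_of_prod_pentagonKernel_eq_zero f fun t m m' hmm' => ?_
  have h0 : ∏ k, pentagonKernel (alphaE ε) (f m k) (f m' k) = 0 := by
    rw [← sum_sqrt_Wn hε hε']
    refine Finset.sum_eq_zero fun y _ => ?_
    by_cases hy : φ y = m
    · rw [hz m' y (hy ▸ hmm'), mul_zero, Real.sqrt_zero]
    · rw [hz m y hy, zero_mul, Real.sqrt_zero]
  obtain ⟨k, -, hk⟩ := Finset.prod_eq_zero_iff.1 h0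
  refine Finset.prod_eq_zero (Finset.mem_univ k) ?_
  unfold pentagonKernel at hk ⊢
  split_ifs at hk ⊢ with h1 h2
  · exact absurd hk one_ne_zero
  · exact absurd hk (alphaE_pos hε hε').ne'
  · rfl

/-- A code `v` on `ZMod 5` of length `n` is combined with the zero-error code
`{(a, 2 a)}` and padded with one unused coordinate. -/
lemma Pe_le_of_code {ε : ℝ} (hε : 0 < ε) (hε' : ε ≤ 1 / 2) {M n K : ℕ} (hM : 0 < M)
    (hMK : M ≤ 5 ^ n * K) (v : Fin K → (Fin n → ZMod 5)) {B : ℝ}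
    (hB : ∀ i, ∑ j ∈ Finset.univ.erase i,
      ∏ k, (if v i k = v j k then 1 else alphaE ε * (1 + alphaE ε)) ≤ B) :
    Pe 5 ε M (n + n + 1) ≤ B := by
  have hα := alphaE_pos hε hε'
  set z := alphaE ε * (1 + alphaE ε) with hz
  have hcard : Fintype.card (Fin M) ≤ Fintype.card ((Fin n → ZMod 5) × Fin K) := by
    simpa [ZMod.card] using hMK
  obtain ⟨g⟩ := Function.Embedding.nonempty_of_card_le hcard
  let c : (Fin n → ZMod 5) × Fin K → (Fin (n + n + 1) → ZMod 5) := fun p =>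
    Fin.snoc (Fin.append p.1 fun k => 2 * p.1 k + v p.2 k) 0
  have hc : ∀ p p', ∏ k, pentagonKernel (alphaE ε) (c p k) (c p' k) =
      ∏ k, pentagonKernel (alphaE ε) (p.1 k) (p'.1 k) *
        pentagonKernel (alphaE ε) (2 * p.1 k + v p.2 k) (2 * p'.1 k + v p'.2 k) := by
    intro p p'
    rw [Fin.prod_univ_castSucc, Fin.prod_univ_add, Finset.prod_mul_distrib]
    simp only [c, Fin.snoc_castSucc, Fin.snoc_last, Fin.append_left, Fin.append_right]
    simp [pentagonKernel]
  have hnn : ∀ p p', 0 ≤ ∏ k, pentagonKernel (alphaE ε) (c p k) (c p' k) := fun p p' =>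
    Finset.prod_nonneg fun k _ => by
      unfold pentagonKernel; split_ifs <;> linarith
  have hsum : ∀ p, ∑ p', ∏ k, pentagonKernel (alphaE ε) (c p k) (c p' k) =
      ∑ j, ∏ k, (if v p.2 k = v j k then 1 else z) := by
    intro p
    rw [Fintype.sum_prod_type, Finset.sum_comm]
    refine Finset.sum_congr rfl fun j _ => ?_
    rw [Finset.sum_congr rfl fun a _ => hc p (a, j),
      ← Fintype.prod_sum fun k a => pentagonKernel (alphaE ε) (p.1 k) a *
        pentagonKernel (alphaE ε) (2 * p.1 k + v p.2 k) (2 * a + v j k)]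
    exact Finset.prod_congr rfl fun k _ => sum_pentagonKernel_mul _ _ _ _
  refine Pe_le_of_forall_sum_le hε hε' hM (fun m => c (g m)) fun m => ?_
  calc ∑ m' ∈ Finset.univ.erase m, ∏ k, pentagonKernel (alphaE ε) (c (g m) k) (c (g m') k)
      = ∑ p' ∈ (Finset.univ.erase m).map g,
          ∏ k, pentagonKernel (alphaE ε) (c (g m) k) (c p' k) := by rw [Finset.sum_map]
    _ ≤ ∑ p' ∈ Finset.univ.erase (g m), ∏ k, pentagonKernel (alphaE ε) (c (g m) k) (c p' k) := by
        refine Finset.sum_le_sum_of_subset_of_nonneg ?_ fun _ _ _ => hnn _ _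
        intro p' hp'
        obtain ⟨m', hm', rfl⟩ := Finset.mem_map.1 hp'
        exact Finset.mem_erase.2
          ⟨fun h => (Finset.mem_erase.1 hm').1 (g.injective h), Finset.mem_univ _⟩
    _ = ∑ j ∈ Finset.univ.erase (g m).2, ∏ k, (if v (g m).2 k = v j k then 1 else z) := by
        have h1 := Finset.add_sum_erase Finset.univ
          (fun p' => ∏ k, pentagonKernel (alphaE ε) (c (g m) k) (c p' k)) (Finset.mem_univ (g m))
        have h2 := Finset.add_sum_erase Finset.univ
          (fun j => ∏ k, (if v (g m).2 k = v j k then 1 else z)) (Finset.mem_univ (g m).2)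
        rw [hsum] at h1
        simp only [pentagonKernel, if_true, Finset.prod_const_one] at h1 h2
        simp only [pentagonKernel]
        linarith
    _ ≤ B := hB _

/-- In a configuration of minimal total energy, the energy of every point is at most the average
energy of a point put at a uniformly random place. -/
lemma exists_forall_sum_le_average {X : Type*} [Fintype X] [Nonempty X] (κ : X → X → ℝ)
    (hκ : ∀ x y, κ x y = κ y x) {A : ℝ} (hA : ∀ y, ∑ x, κ x y = Fintype.card X * A)
    (hA0 : 0 ≤ A) (K : ℕ) :
    ∃ v : Fin K → X, ∀ i, ∑ j ∈ Finset.univ.erase i, κ (v i) (v j) ≤ K * A := by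
  obtain ⟨v, hv⟩ := Finite.exists_min fun v : Fin K → X =>
    ∑ i, ∑ j ∈ Finset.univ.erase i, κ (v i) (v j)
  refine ⟨v, fun i => ?_⟩
  have hsplit : ∀ u : Fin K → X, ∑ a, ∑ b ∈ Finset.univ.erase a, κ (u a) (u b) =
      2 * ∑ b ∈ Finset.univ.erase i, κ (u i) (u b) + ∑ a ∈ Finset.univ.erase i,
        ∑ b ∈ (Finset.univ.erase a).erase i, κ (u a) (u b) := by
    intro u
    rw [← Finset.add_sum_erase _ _ (Finset.mem_univ i)]
    have : ∀ a ∈ Finset.univ.erase i, ∑ b ∈ Finset.univ.erase a, κ (u a) (u b) =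
        κ (u i) (u a) + ∑ b ∈ (Finset.univ.erase a).erase i, κ (u a) (u b) := fun a ha => by
      rw [hκ (u i), Finset.add_sum_erase _ (fun b => κ (u a) (u b))]
      exact Finset.mem_erase.2 ⟨(Finset.mem_erase.1 ha).1.symm, Finset.mem_univ _⟩
    rw [Finset.sum_congr rfl this, Finset.sum_add_distrib]
    ring
  have hmove : ∀ w, ∑ j ∈ Finset.univ.erase i, κ (v i) (v j) ≤
      ∑ j ∈ Finset.univ.erase i, κ w (v j) := by
    intro w
    have h := hv (Function.update v i w)
    simp only [hsplit] at h
    have h1 : ∑ b ∈ Finset.univ.erase i, κ (Function.update v i w i) (Function.update v i w b) =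
        ∑ j ∈ Finset.univ.erase i, κ w (v j) :=
      Finset.sum_congr rfl fun b hb => by
        rw [Function.update_self, Function.update_of_ne (Finset.mem_erase.1 hb).1]
    have h2 : ∑ a ∈ Finset.univ.erase i, ∑ b ∈ (Finset.univ.erase a).erase i,
        κ (Function.update v i w a) (Function.update v i w b) =
        ∑ a ∈ Finset.univ.erase i, ∑ b ∈ (Finset.univ.erase a).erase i, κ (v a) (v b) :=
      Finset.sum_congr rfl fun a ha => Finset.sum_congr rfl fun b hb => by
        rw [Function.update_of_ne (Finset.mem_erase.1 ha).1,
          Function.update_of_ne (Finset.mem_erase.1 hb).1]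
    rw [h1, h2] at h
    linarith
  have hX : (0 : ℝ) < Fintype.card X := by exact_mod_cast Fintype.card_pos
  have h : Fintype.card X * ∑ j ∈ Finset.univ.erase i, κ (v i) (v j) ≤
      Fintype.card X * (K * A) := by
    calc Fintype.card X * ∑ j ∈ Finset.univ.erase i, κ (v i) (v j)
        = ∑ _w : X, ∑ j ∈ Finset.univ.erase i, κ (v i) (v j) := by
          rw [Finset.sum_const, Finset.card_univ, nsmul_eq_mul]
      _ ≤ ∑ w, ∑ j ∈ Finset.univ.erase i, κ w (v j) := Finset.sum_le_sum fun w _ => hmove w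
      _ = ∑ j ∈ Finset.univ.erase i, Fintype.card X * A := by
        rw [Finset.sum_comm]
        exact Finset.sum_congr rfl fun j _ => hA _
      _ ≤ ∑ _j : Fin K, Fintype.card X * A :=
        Finset.sum_le_sum_of_subset_of_nonneg (Finset.erase_subset _ _)
          fun _ _ _ => mul_nonneg hX.le hA0
      _ = Fintype.card X * (K * A) := by simp; ring
  exact le_of_mul_le_mul_left h hX

lemma exists_code_sum_le {s : ℝ} (hs : 0 ≤ s) (n K : ℕ) :
    ∃ v : Fin K → (Fin n → ZMod 5), ∀ i, ∑ j ∈ Finset.univ.erase i,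
      ∏ k, (if v i k = v j k then 1 else s) ≤ K * ((1 + 4 * s) / 5) ^ n := by
  refine exists_forall_sum_le_average
    (fun x y : Fin n → ZMod 5 => ∏ k, (if x k = y k then 1 else s)) ?_ ?_ (by positivity) K
  · intro x y
    simp_rw [eq_comm]
  · intro y
    have h : ∀ k, ∑ a : ZMod 5, (if a = y k then 1 else s) = 1 + 4 * s := fun k => by
      rw [Finset.sum_ite, Finset.filter_eq', Finset.filter_ne']
      simp [ZMod.card]
    rw [← Fintype.prod_sum fun k (a : ZMod 5) => if a = y k then (1 : ℝ) else s]
    simp [h, ZMod.card, div_pow]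
    field_simp

lemma sum_rpow_le_rpow_sum {ι : Type*} (S : Finset ι) (a : ι → ℝ) (ha : ∀ i ∈ S, 0 ≤ a i)
    {ρ : ℝ} (hρ : 1 ≤ ρ) : ∑ i ∈ S, a i ^ ρ ≤ (∑ i ∈ S, a i) ^ ρ := by
  have hsplit : ∀ x : ℝ, 0 ≤ x → x ^ ρ = x * x ^ (ρ - 1) := fun x hx => by
    conv_lhs => rw [show ρ = 1 + (ρ - 1) by ring]
    rw [Real.rpow_add_of_nonneg hx zero_le_one (by linarith), Real.rpow_one]
  rw [hsplit _ (Finset.sum_nonneg ha), Finset.sum_mul]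
  refine Finset.sum_le_sum fun i hi => ?_
  rw [hsplit _ (ha i hi)]
  exact mul_le_mul_of_nonneg_left (Real.rpow_le_rpow (ha i hi)
    (Finset.single_le_sum ha hi) (by linarith)) (ha i hi)

/-- The expurgated bound for the code combined with the zero-error code of length two. -/
lemma Pe_le_expurgated {ε : ℝ} (hε : 0 < ε) (hε' : ε ≤ 1 / 2) {M n K : ℕ} (hM : 0 < M)
    (hMK : M ≤ 5 ^ n * K) {s ρ : ℝ} (hs : 0 ≤ s) (hρ : 1 ≤ ρ)
    (hsρ : s ^ ρ = alphaE ε * (1 + alphaE ε)) :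
    Pe 5 ε M (n + n + 1) ≤ (K * ((1 + 4 * s) / 5) ^ n) ^ ρ := by
  obtain ⟨v, hv⟩ := exists_code_sum_le hs n K
  refine Pe_le_of_code hε hε' hM hMK v fun i => ?_
  have hnn : ∀ j k, 0 ≤ if v i k = v j k then 1 else s := fun j k => by
    split_ifs
    exacts [zero_le_one, hs]
  calc ∑ j ∈ Finset.univ.erase i, ∏ k, (if v i k = v j k then 1 else alphaE ε * (1 + alphaE ε))
      = ∑ j ∈ Finset.univ.erase i, (∏ k, (if v i k = v j k then 1 else s)) ^ ρ := by
        refine Finset.sum_congr rfl fun j _ => ?_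
        rw [← Real.finsetProd_rpow _ _ fun k _ => hnn j k]
        refine Finset.prod_congr rfl fun k _ => ?_
        split_ifs
        exacts [(Real.one_rpow ρ).symm, hsρ.symm]
    _ ≤ (∑ j ∈ Finset.univ.erase i, ∏ k, (if v i k = v j k then 1 else s)) ^ ρ :=
        sum_rpow_le_rpow_sum _ _ (fun j _ => Finset.prod_nonneg fun k _ => hnn j k) hρ
    _ ≤ _ := Real.rpow_le_rpow
        (Finset.sum_nonneg fun j _ => Finset.prod_nonneg fun k _ => hnn j k) (hv i) (by linarith)

lemma h5_eq_qaryEntropy (x : ℝ) : h5 x = Real.qaryEntropy 5 x / Real.log 2 := by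
  rw [h5, Real.qaryEntropy, Real.binEntropy_eq_negMulLog_add_negMulLog_one_sub]
  simp only [Real.negMulLog, Real.logb]
  norm_num
  ring

lemma h5_strictMonoOn : StrictMonoOn h5 (Set.Icc 0 (4 / 5)) := by
  intro x hx y hy hxy
  have h : (1 - 1 / ((5 : ℕ) : ℝ)) = 4 / 5 := by norm_num
  have := Real.qaryEntropy_strictMonoOn (q := 5) (by norm_num)
  rw [h] at this
  rw [h5_eq_qaryEntropy, h5_eq_qaryEntropy]
  exact div_lt_div_of_pos_right (this hx hy hxy) (Real.log_pos one_lt_two)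

lemma h5_four_fifths : h5 (4 / 5) = Real.logb 2 5 := by
  have h4 : Real.logb 2 (4 / 5) = Real.logb 2 4 - Real.logb 2 5 :=
    Real.logb_div (by norm_num) (by norm_num)
  have h1 : Real.logb 2 (1 - 4 / 5) = - Real.logb 2 5 := by
    rw [← Real.logb_inv]; norm_num
  rw [h5, h4, h1]
  ring

lemma alphaE_le_half (ε : ℝ) : alphaE ε ≤ 1 / 2 := by
  rw [alphaE, Real.sqrt_le_left (by norm_num)]
  nlinarith [sq_nonneg (ε - 1 / 2)]

/-- The optimal parameter of the expurgated bound at the Gilbert–Varshamov distance. -/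
lemma two_rpow_mul_eq {δ : ℝ} (hδ0 : 0 < δ) (hδ1 : δ < 1) :
    (2 : ℝ) ^ (Real.logb 2 5 - h5 δ) * ((1 + 4 * (δ / (4 * (1 - δ)))) / 5) =
      (δ / (4 * (1 - δ))) ^ δ := by
  have h1 : 0 < 1 - δ := by linarith
  have hl : Real.log 2 ≠ 0 := (Real.log_pos one_lt_two).ne'
  have e1 : (1 + 4 * (δ / (4 * (1 - δ)))) / 5 = ((1 - δ) * 5)⁻¹ := by
    field_simp
    ring
  have hs : 0 < δ / (4 * (1 - δ)) := by positivity
  rw [e1]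
  refine Real.log_injOn_pos (Set.mem_Ioi.2 (by positivity)) (Set.mem_Ioi.2 (by positivity)) ?_
  rw [Real.log_mul (by positivity) (by positivity), Real.log_rpow two_pos, Real.log_rpow hs,
    Real.log_inv, Real.log_mul h1.ne' (by norm_num), Real.log_div hδ0.ne' (by positivity),
    Real.log_mul (by norm_num) h1.ne', h5]
  simp only [Real.logb]
  field_simp
  ring

lemma sqrt_five_pow_le_two_rpow {R : ℝ} (hR1 : Real.logb 2 (√5) ≤ R) (n : ℕ) :
    √5 ^ n ≤ (2 : ℝ) ^ ((n : ℝ) * R) := by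
  calc √5 ^ n = ((2 : ℝ) ^ Real.logb 2 (√5)) ^ n := by
        rw [Real.rpow_logb (by norm_num) (by norm_num) (by positivity)]
    _ = (2 : ℝ) ^ ((n : ℝ) * Real.logb 2 (√5)) := by
        rw [← Real.rpow_natCast, ← Real.rpow_mul (by norm_num), mul_comm]
    _ ≤ _ := by
        gcongr
        norm_num

lemma logb_sqrt_five : Real.logb 2 (√5) = Real.logb 2 5 / 2 := by
  rw [Real.logb, Real.log_sqrt (by norm_num), Real.logb]
  ring

/-- At odd block lengths the number of messages exceeds the zero-error bound. -/
lemma Pe_ne_zero_of_odd {ε : ℝ} (hε : 0 < ε) (hε' : ε ≤ 1 / 2) {R : ℝ}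
    (hR1 : Real.logb 2 (√5) ≤ R) (n : ℕ) :
    Pe 5 ε ⌈(2 : ℝ) ^ (((n + n + 1 : ℕ) : ℝ) * R)⌉₊ (n + n + 1) ≠ 0 := by
  intro h
  have hle := sq_le_of_Pe_eq_zero hε hε' (Nat.ceil_pos.2 (by positivity)) h
  have hge := (sqrt_five_pow_le_two_rpow hR1 (n + n + 1)).trans (Nat.le_ceil _)
  generalize ⌈(2 : ℝ) ^ (((n + n + 1 : ℕ) : ℝ) * R)⌉₊ = M at hle hge
  have hge' : 5 ^ (n + n + 1) ≤ M ^ 2 := by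
    have : (5 : ℝ) ^ (n + n + 1) ≤ (M : ℝ) ^ 2 := by
      calc (5 : ℝ) ^ (n + n + 1) = (√5 ^ (n + n + 1)) ^ 2 := by
            rw [← pow_mul, mul_comm, pow_mul, Real.sq_sqrt (by norm_num)]
        _ ≤ _ := by gcongr
    exact_mod_cast this
  have hf := congrArg (fun m => m.factorization 5) (le_antisymm hle hge')
  simp [Nat.Prime.factorization_self (p := 5) (by norm_num)] at hf
  omega

lemma exists_Pe_le {ε : ℝ} (hε : 0 < ε) (hε' : ε ≤ 1 / 2) {R δ : ℝ}
    (hR1 : Real.logb 2 (√5) ≤ R)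
    (hR2 : R ≤ Real.logb 2 5 - (1 / 2) * h5 (1 - ((1 + 2 * alphaE ε) ^ 2)⁻¹))
    (hδ0 : 0 ≤ δ) (hδ1 : δ ≤ 4 / 5)
    (hδeq : 2 * R - Real.logb 2 5 = Real.logb 2 5 - h5 δ) :
    ∃ C : ℝ, 0 < C ∧ ∀ n : ℕ,
      Pe 5 ε ⌈(2 : ℝ) ^ (((n + n + 1 : ℕ) : ℝ) * R)⌉₊ (n + n + 1) ≤
        C * ((alphaE ε * (1 + alphaE ε)) ^ δ) ^ n := by
  have hα := alphaE_pos hε hε'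
  have hα' := alphaE_le_half ε
  set z := alphaE ε * (1 + alphaE ε) with hz
  have hz0 : 0 < z := by positivity
  have hz1 : z < 1 := by nlinarith
  have hM : ∀ n : ℕ, 0 < ⌈(2 : ℝ) ^ (((n + n + 1 : ℕ) : ℝ) * R)⌉₊ := fun n =>
    Nat.ceil_pos.2 (by positivity)
  have hpow : ∀ n : ℕ, (2 : ℝ) ^ (((n + n + 1 : ℕ) : ℝ) * R) =
      5 ^ n * (2 ^ R * (2 ^ (2 * R - Real.logb 2 5)) ^ n) := by
    intro n
    have h5 : (5 : ℝ) = 2 ^ Real.logb 2 5 :=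
      (Real.rpow_logb (by norm_num) (by norm_num) (by norm_num)).symm
    have : (5 : ℝ) ^ n = (2 ^ Real.logb 2 5) ^ n := by rw [← h5]
    rw [this, ← Real.rpow_natCast, ← Real.rpow_natCast, ← Real.rpow_mul two_pos.le,
      ← Real.rpow_mul two_pos.le, ← Real.rpow_add two_pos, ← Real.rpow_add two_pos]
    congr 1
    push_cast
    ring
  rcases hδ1.eq_or_lt with rfl | hδ1
  · rw [h5_four_fifths, sub_self] at hδeq
    have hR : (2 : ℝ) ^ R ≤ 5 := by
      have : R = Real.logb 2 5 / 2 := by linarith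
      rw [this, ← logb_sqrt_five, Real.rpow_logb (by norm_num) (by norm_num) (by positivity),
        Real.sqrt_le_left (by norm_num)]
      norm_num
    refine ⟨5, by norm_num, fun n => ?_⟩
    have hMK : ⌈(2 : ℝ) ^ (((n + n + 1 : ℕ) : ℝ) * R)⌉₊ ≤ 5 ^ n * 5 := by
      refine Nat.ceil_le.2 ?_
      rw [hpow, hδeq]
      push_cast
      gcongr
      simpa using hR
    refine Pe_le_of_code hε hε' (hM n) hMK (fun i _ => ((i : ℕ) : ZMod 5)) fun i => ?_
    have hij : ∀ j ∈ Finset.univ.erase i,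
        ∏ _k : Fin n, (if ((i : ℕ) : ZMod 5) = ((j : ℕ) : ZMod 5) then 1 else z) = z ^ n := by
      intro j hj
      have : ∀ a b : Fin 5, ((a : ℕ) : ZMod 5) = ((b : ℕ) : ZMod 5) → b = a := by decide
      rw [if_neg fun h => (Finset.mem_erase.1 hj).1 (this i j h)]
      simp
    rw [← hz, Finset.sum_congr rfl hij]
    have hzn : z ^ n ≤ (z ^ (4 / 5 : ℝ)) ^ n := by
      gcongr
      exact Real.self_le_rpow_of_le_one hz0.le hz1.le (by norm_num)
    have : 0 ≤ z ^ n := by positivity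
    simp
    linarith
  · have hp0 : 0 < 1 - ((1 + 2 * alphaE ε) ^ 2)⁻¹ :=
      sub_pos.2 (inv_lt_one_of_one_lt₀ (by nlinarith))
    have hp1 : 1 - ((1 + 2 * alphaE ε) ^ 2)⁻¹ ≤ 4 / 5 := by
      have : (5 : ℝ)⁻¹ ≤ ((1 + 2 * alphaE ε) ^ 2)⁻¹ := by
        gcongr
        nlinarith
      linarith
    have hpδ : 1 - ((1 + 2 * alphaE ε) ^ 2)⁻¹ ≤ δ :=
      (h5_strictMonoOn.le_iff_le ⟨hp0.le, hp1⟩ ⟨hδ0, hδ1.le⟩).1 (by linarith)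
    have hδpos : 0 < δ := hp0.trans_le hpδ
    have h1δ : 0 < 1 - δ := by linarith
    set s := δ / (4 * (1 - δ)) with hs
    have hs0 : 0 < s := by positivity
    have hs1 : s < 1 := by
      rw [hs, div_lt_one (by positivity)]
      linarith
    have hzs : z ≤ s := by
      rw [hs, le_div_iff₀ (by positivity)]
      have h4 : (1 + 2 * alphaE ε) ^ 2 = 1 + 4 * z := by rw [hz]; ring
      rw [h4, sub_le_comm, le_inv_comm₀ h1δ (by positivity), le_inv_comm₀ (by positivity) h1δ,
        ← one_div, le_div_iff₀ (by positivity)] at hpδ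
      nlinarith
    have hρ : 1 ≤ Real.logb s z := by
      rw [Real.le_logb_iff_rpow_le_of_base_lt_one hs0 hs1 hz0, Real.rpow_one]
      exact hzs
    have hsρ : s ^ Real.logb s z = z := Real.rpow_logb hs0 hs1.ne hz0
    set ρ := Real.logb s z
    have hr : 0 ≤ 2 * R - Real.logb 2 5 := by
      rw [logb_sqrt_five] at hR1
      linarith
    have hRnn : 0 ≤ R := by
      have : 0 ≤ Real.logb 2 5 := Real.logb_nonneg (by norm_num) (by norm_num)
      linarith
    refine ⟨(2 * 2 ^ R) ^ ρ, by positivity, fun n => ?_⟩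
    set x : ℝ := 2 ^ R * (2 ^ (2 * R - Real.logb 2 5)) ^ n with hx
    have hx1 : 1 ≤ x := by
      have h1 := Real.one_le_rpow one_le_two hRnn
      have h2 := one_le_pow₀ (n := n) (Real.one_le_rpow one_le_two hr)
      nlinarith
    have hMK : ⌈(2 : ℝ) ^ (((n + n + 1 : ℕ) : ℝ) * R)⌉₊ ≤ 5 ^ n * ⌈x⌉₊ := by
      refine Nat.ceil_le.2 ?_
      rw [hpow]
      push_cast
      gcongr
      exact Nat.le_ceil x
    refine (Pe_le_expurgated hε hε' (hM n) hMK hs0.le hρ hsρ).trans ?_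
    have hK : (⌈x⌉₊ : ℝ) ≤ 2 * x := by
      have := Nat.ceil_lt_add_one (zero_le_one.trans hx1)
      linarith
    calc ((⌈x⌉₊ : ℝ) * ((1 + 4 * s) / 5) ^ n) ^ ρ
        ≤ (2 * x * ((1 + 4 * s) / 5) ^ n) ^ ρ := by gcongr
      _ = (2 * 2 ^ R * (s ^ δ) ^ n) ^ ρ := by
          rw [← two_rpow_mul_eq hδpos (by linarith), ← hs, ← hδeq, hx, mul_pow]
          ring_nf
      _ = (2 * 2 ^ R) ^ ρ * (z ^ δ) ^ n := by
          rw [Real.mul_rpow (by positivity) (by positivity), ← hsρ, ← Real.rpow_natCast,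
            ← Real.rpow_natCast, ← Real.rpow_mul hs0.le, ← Real.rpow_mul hs0.le,
            ← Real.rpow_mul hs0.le, ← Real.rpow_mul hs0.le]
          ring_nf

lemma isBoundedUnder_exponent {ε : ℝ} (hε : 0 < ε) (hε' : ε ≤ 1 / 2) {R : ℝ} (hR : 0 ≤ R) :
    Filter.IsBoundedUnder (· ≤ ·) Filter.atTop (fun n : ℕ =>
      (1 / (n : ℝ)) * Real.logb 2 (1 / Pe 5 ε (⌈(2 : ℝ) ^ ((n : ℝ) * R)⌉₊) n)) := by
  have hlog : 0 ≤ Real.logb 2 ε⁻¹ :=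
    Real.logb_nonneg one_lt_two ((one_le_inv₀ hε).2 (by linarith))
  refine Filter.isBoundedUnder_of_eventually_le (a := R + 1 + Real.logb 2 ε⁻¹) ?_
  filter_upwards [Filter.eventually_ge_atTop 1] with n hn
  have hn' : (1 : ℝ) ≤ n := by exact_mod_cast hn
  have hpos : (0 : ℝ) < 2 ^ ((n : ℝ) * R) := by positivity
  have hM := Nat.ceil_pos.2 hpos
  have hMle : (⌈(2 : ℝ) ^ ((n : ℝ) * R)⌉₊ : ℝ) ≤ 2 ^ ((n : ℝ) * R + 1) := by
    have h1 := Nat.ceil_lt_add_one hpos.le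
    have h2 : (1 : ℝ) ≤ 2 ^ ((n : ℝ) * R) := Real.one_le_rpow one_le_two (by positivity)
    rw [Real.rpow_add two_pos, Real.rpow_one]
    linarith
  generalize ⌈(2 : ℝ) ^ ((n : ℝ) * R)⌉₊ = M at hM hMle
  have hM' : (0 : ℝ) < M := by exact_mod_cast hM
  rcases Pe_eq_zero_or_le hε hε' hM n with h | h
  · rw [h, div_zero, Real.logb_zero, mul_zero]
    linarith
  · have hPe : 1 / Pe 5 ε M n ≤ 2 ^ ((n : ℝ) * R + 1) * ε⁻¹ ^ n := by
      calc 1 / Pe 5 ε M n ≤ 1 / (1 / M * ε ^ n) :=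
            one_div_le_one_div_of_le (by positivity) h
        _ = M * ε⁻¹ ^ n := by
            rw [inv_pow]
            field_simp
        _ ≤ _ := by gcongr
    have hPe0 : 0 < Pe 5 ε M n := lt_of_lt_of_le (by positivity) h
    have hl := Real.logb_le_logb_of_le one_lt_two (by positivity) hPe
    rw [Real.logb_mul (by positivity) (by positivity), Real.logb_pow,
      Real.logb_rpow two_pos (by norm_num)] at hl
    rw [one_div, inv_mul_le_iff₀ (by positivity)]
    nlinarith

/- Statement 5: for `q = 5`, with `δ = δ_GV(2R - log₂ 5; 5) ∈ [0, 4/5]` the unique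
solution of `2R - log₂ 5 = log₂ 5 - h₅(δ)`, and for
`log₂ √5 ≤ R ≤ R₊* = log₂ 5 - (1/2) h₅(1 - (1+2α)⁻²)`, one has
`E(R) ≥ -(1/2) δ log₂(α(1+α))`. -/
theorem stmt5 (ε : ℝ) (hε : 0 < ε) (hε' : ε ≤ 1 / 2)
    (R δ : ℝ)
    (hR1 : Real.logb 2 (Real.sqrt 5) ≤ R)
    (hR2 : R ≤ Real.logb 2 5 - (1 / 2) * h5 (1 - ((1 + 2 * alphaE ε) ^ 2)⁻¹))
    (hδ0 : 0 ≤ δ) (hδ1 : δ ≤ 4 / 5)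
    (hδeq : 2 * R - Real.logb 2 5 = Real.logb 2 5 - h5 δ) :
    -(1 / 2) * δ * Real.logb 2 (alphaE ε * (1 + alphaE ε)) ≤ EReliability 5 ε R := by
  obtain ⟨C, hC, hPe⟩ := exists_Pe_le hε hε' hR1 hR2 hδ0 hδ1 hδeq
  have hα := alphaE_pos hε hε'
  set z := alphaE ε * (1 + alphaE ε) with hz
  have hz0 : 0 < z := by positivity
  have hR : 0 ≤ R := by
    refine le_trans (Real.logb_nonneg one_lt_two ?_) hR1
    rw [Real.one_le_sqrt]
    norm_num
  refine le_of_forall_lt fun b hb => ?_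
  obtain ⟨b', hbb', hb'⟩ := exists_between hb
  refine lt_of_lt_of_le hbb' (Filter.le_limsup_of_frequently_le ?_
    (isBoundedUnder_exponent hε hε' hR))
  have htend : Filter.Tendsto (fun n : ℕ => n + n + 1) Filter.atTop Filter.atTop :=
    Filter.tendsto_atTop_mono (fun n => (by omega : n ≤ n + n + 1)) Filter.tendsto_id
  refine htend.frequently (Filter.Eventually.frequently ?_)
  have hD : 0 < -δ * Real.logb 2 z - 2 * b' := by linarith
  filter_upwards [(tendsto_natCast_atTop_atTop.atTop_mul_const hD).eventually_ge_atTop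
    (b' + Real.logb 2 C)] with n hn
  have hM : 0 < ⌈(2 : ℝ) ^ (((n + n + 1 : ℕ) : ℝ) * R)⌉₊ := Nat.ceil_pos.2 (by positivity)
  have hpos : 0 < Pe 5 ε ⌈(2 : ℝ) ^ (((n + n + 1 : ℕ) : ℝ) * R)⌉₊ (n + n + 1) :=
    lt_of_lt_of_le (by positivity)
      ((Pe_eq_zero_or_le hε hε' hM _).resolve_left (Pe_ne_zero_of_odd hε hε' hR1 n))
  have hl := Real.logb_le_logb_of_le one_lt_two hpos (hPe n)
  rw [Real.logb_mul hC.ne' (by positivity), Real.logb_pow, Real.logb_rpow_eq_mul_logb_of_pos hz0]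
    at hl
  rw [one_div (Pe _ _ _ _), Real.logb_inv, one_div, le_inv_mul_iff₀ (by positivity)]
  push_cast at hl ⊢
  linarith
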